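/- Let φ : ℝ → ℝ be twice continuously differentiable with φ, φ', φ'' all of at most polynomial growth. Fix q > 0 and c ∈ (−1,1), and let u₁, u₂ be independent standard Gaussians. For ε > −q(1−c²), define F(ε) = E[ φ(√q u₁) · φ( √q c u₁ + √(q(1−c²)+ε) u₂ ) ]. Then F is differentiable at ε = 0 and F'(0) = (1/2) · E[ φ(√q u₁) · φ''( √q c u₁ + √(q(1−c²)) u₂ ) ]. -/

import Mathlib

open MeasureTheory ProbabilityTheory

lemma aux_int_pow (n : ℕ) : Integrable (fun x : ℝ => (1 + |x|) ^ n) (gaussianReal 0 1) := by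
  have h1 : MemLp (fun x : ℝ => 1 + |x|) (n : ENNReal) (gaussianReal 0 1) := by
    have h := (memLp_id_gaussianReal' (μ := 0) (v := 1) (n : ENNReal) (by simp)).norm
    exact (memLp_const (1 : ℝ)).add h
  have h2 := h1.integrable_norm_pow'
  refine h2.congr (Filter.Eventually.of_forall fun x => ?_)
  simp only [Real.norm_eq_abs]
  rw [abs_of_nonneg (by positivity)]

lemma aux_int_growth (g : ℝ → ℝ) (hg : Continuous g) (C : ℝ) (n : ℕ)
    (h : ∀ x, |g x| ≤ C * (1 + |x|) ^ n) : Integrable g (gaussianReal 0 1) := by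
  refine ((aux_int_pow n).const_mul C).mono' hg.aestronglyMeasurable ?_
  exact Filter.Eventually.of_forall fun x => by simpa using h x

lemma aux_int_vol (g : ℝ → ℝ) (hg : Integrable g (gaussianReal 0 1)) :
    Integrable (fun x => g x * gaussianPDFReal 0 1 x) := by
  rw [gaussianReal_of_var_ne_zero 0 (one_ne_zero)] at hg
  rw [integrable_withDensity_iff_integrable_smul' (measurable_gaussianPDF 0 1)
    (Filter.Eventually.of_forall fun x => gaussianPDF_lt_top)] at hg
  refine hg.congr (Filter.Eventually.of_forall fun x => ?_)
  simp only [toReal_gaussianPDF, smul_eq_mul]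
  ring

lemma aux_pdf_deriv (x : ℝ) :
    HasDerivAt (gaussianPDFReal 0 1) (-x * gaussianPDFReal 0 1 x) x := by
  have h : HasDerivAt (fun x : ℝ => -(x - 0) ^ 2 / (2 * ((1 : NNReal) : ℝ))) (-x) x := by
    have := (((hasDerivAt_id x).sub_const 0).pow 2).neg.div_const (2 * ((1 : NNReal) : ℝ))
    refine this.congr_deriv ?_
    simp
    ring
  have h2 := (h.exp).const_mul (Real.sqrt (2 * Real.pi * ((1 : NNReal) : ℝ)))⁻¹
  rw [gaussianPDFReal_def]
  refine h2.congr_deriv ?_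
  ring

lemma aux_stein (g g' : ℝ → ℝ) (hd : ∀ x, HasDerivAt g (g' x) x) (hg' : Continuous g')
    (C : ℝ) (n : ℕ) (h : ∀ x, |g x| ≤ C * (1 + |x|) ^ n)
    (h' : ∀ x, |g' x| ≤ C * (1 + |x|) ^ n) :
    ∫ x, x * g x ∂(gaussianReal 0 1) = ∫ x, g' x ∂(gaussianReal 0 1) := by
  have hg : Continuous g := continuous_iff_continuousAt.2 fun x => (hd x).continuousAt
  have i1 := aux_int_vol g (aux_int_growth g hg C n h)
  have i2 := aux_int_vol g' (aux_int_growth g' hg' C n h')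
  have i3 := aux_int_vol (fun x => x * g x) (aux_int_growth _ (by fun_prop) C (n + 1) (by
    intro x
    rw [abs_mul, pow_succ]
    have := h x
    have h0 := abs_nonneg (g x)
    have h1 := abs_nonneg x
    nlinarith))
  have key := integral_mul_deriv_eq_deriv_mul_of_integrable (u := g) (v := gaussianPDFReal 0 1)
    (u' := g') (v' := fun x => -x * gaussianPDFReal 0 1 x) (fun x _ => hd x)
    (fun x _ => aux_pdf_deriv x)
    (i3.neg.congr (Filter.Eventually.of_forall fun x => by simp; ring)) i2 i1
  rw [integral_gaussianReal_eq_integral_smul one_ne_zero,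
    integral_gaussianReal_eq_integral_smul one_ne_zero]
  simp only [smul_eq_mul]
  have e1 : ∫ x, gaussianPDFReal 0 1 x * (x * g x) =
      - ∫ x, g x * (-x * gaussianPDFReal 0 1 x) := by
    rw [← integral_neg]; congr 1; ext x; ring
  rw [e1, key, neg_neg]
  congr 1; ext x; ring

lemma aux_lin (M a b x y : ℝ) (hM : 1 ≤ M) (ha : |a| ≤ M) (hb : |b| ≤ M) :
    1 + |a * x + b * y| ≤ M * ((1 + |x|) * (1 + |y|)) := by
  have h1 := abs_add_le (a * x) (b * y)
  rw [abs_mul, abs_mul] at h1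
  have h2 := mul_le_mul_of_nonneg_right ha (abs_nonneg x)
  have h3 := mul_le_mul_of_nonneg_right hb (abs_nonneg y)
  have h4 : 0 ≤ M * (|x| * |y|) := by positivity
  nlinarith

lemma aux_growth2 (g : ℝ → ℝ) (C : ℝ) (hC : 0 ≤ C) (m : ℕ)
    (h : ∀ x, |g x| ≤ C * (1 + |x|) ^ m)
    (M a b x y : ℝ) (hM : 1 ≤ M) (ha : |a| ≤ M) (hb : |b| ≤ M) :
    |g (a * x + b * y)| ≤ C * M ^ m * (1 + |x|) ^ m * (1 + |y|) ^ m := by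
  refine (h _).trans ?_
  have := pow_le_pow_left₀ (by positivity) (aux_lin M a b x y hM ha hb) m
  rw [mul_pow, mul_pow] at this
  calc _ ≤ C * _ := mul_le_mul_of_nonneg_left this hC
    _ = _ := by ring

/-- Off-diagonal response of the mean-field C-map to a diagonal perturbation: for `φ`
twice continuously differentiable with `φ, φ', φ''` of at most polynomial growth,
`q > 0`, `c ∈ (−1,1)`, and independent standard Gaussians `u₁, u₂`, the function
`F(ε) = E[φ(√q u₁) φ(√q c u₁ + √(q(1−c²)+ε) u₂)]` is differentiable at `ε = 0` with
`F'(0) = ½ E[φ(√q u₁) φ''(√q c u₁ + √(q(1−c²)) u₂)]`. -/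
theorem stmt8
    (φ : ℝ → ℝ) (hφ : ContDiff ℝ 2 φ)
    (hgrowth : ∃ (C : ℝ) (m : ℕ), ∀ t : ℝ,
      |φ t| + |deriv φ t| + |deriv (deriv φ) t| ≤ C * (1 + |t|) ^ m)
    (q : ℝ) (hq : 0 < q)
    (c : ℝ) (hc : c ∈ Set.Ioo (-1 : ℝ) 1) :
    HasDerivAt
      (fun ε : ℝ =>
        ∫ u : ℝ × ℝ,
          φ (Real.sqrt q * u.1) *
            φ (Real.sqrt q * c * u.1 + Real.sqrt (q * (1 - c ^ 2) + ε) * u.2)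
          ∂((gaussianReal 0 1).prod (gaussianReal 0 1)))
      ((1 / 2) * ∫ u : ℝ × ℝ,
          φ (Real.sqrt q * u.1) *
            deriv (deriv φ) (Real.sqrt q * c * u.1 + Real.sqrt (q * (1 - c ^ 2)) * u.2)
          ∂((gaussianReal 0 1).prod (gaussianReal 0 1)))
      0 := by
  obtain ⟨C, m, hCm⟩ := hgrowth
  have hC : 0 ≤ C := by
    have := hCm 0
    simp only [abs_zero, add_zero, one_pow, mul_one] at this
    exact le_trans (by positivity) this
  have g0 : ∀ t, |φ t| ≤ C * (1 + |t|) ^ m := fun t => by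
    linarith [hCm t, abs_nonneg (deriv φ t), abs_nonneg (deriv (deriv φ) t)]
  have g1 : ∀ t, |deriv φ t| ≤ C * (1 + |t|) ^ m := fun t => by
    linarith [hCm t, abs_nonneg (φ t), abs_nonneg (deriv (deriv φ) t)]
  have g2 : ∀ t, |deriv (deriv φ) t| ≤ C * (1 + |t|) ^ m := fun t => by
    linarith [hCm t, abs_nonneg (φ t), abs_nonneg (deriv φ t)]
  have hφ1 : ContDiff ℝ 1 (deriv φ) :=
    ((contDiff_succ_iff_deriv (n := 1)).1 (by simpa [one_add_one_eq_two] using hφ)).2.2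
  have c0 : Continuous φ := hφ.continuous
  have c1 : Continuous (deriv φ) := hφ1.continuous
  have c2 : Continuous (deriv (deriv φ)) := hφ1.continuous_deriv le_rfl
  have d0 : ∀ x, HasDerivAt φ (deriv φ x) x := fun x =>
    (hφ.differentiable (by norm_num) x).hasDerivAt
  have d1 : ∀ x, HasDerivAt (deriv φ) (deriv (deriv φ) x) x := fun x =>
    (hφ1.differentiable (by norm_num) x).hasDerivAt
  have hv : 0 < q * (1 - c ^ 2) := by
    have : 0 < 1 - c ^ 2 := by nlinarith [hc.1, hc.2]
    positivity
  generalize q * (1 - c ^ 2) = v at hv ⊢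
  generalize Real.sqrt q * c = a
  generalize Real.sqrt q = r
  -- uniform constant
  obtain ⟨M, hM1, hMr, hMa, hMv⟩ : ∃ M : ℝ, 1 ≤ M ∧ |r| ≤ M ∧ |a| ≤ M ∧ √(2 * v) ≤ M :=
    ⟨1 + |r| + |a| + √(2 * v), by
      have := abs_nonneg r
      have := abs_nonneg a
      have := Real.sqrt_nonneg (2 * v)
      refine ⟨?_, ?_, ?_, ?_⟩ <;> linarith⟩
  have hsM : ∀ ε ∈ Metric.ball (0 : ℝ) (v / 2), |√(v + ε)| ≤ M := by
    intro ε hε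
    rw [Metric.mem_ball, dist_zero_right, Real.norm_eq_abs, abs_lt] at hε
    rw [abs_of_nonneg (Real.sqrt_nonneg _)]
    exact (Real.sqrt_le_sqrt (by linarith [hε.2])).trans hMv
  have hs0 : ∀ ε ∈ Metric.ball (0 : ℝ) (v / 2), √(v / 2) ≤ √(v + ε) := by
    intro ε hε
    rw [Metric.mem_ball, dist_zero_right, Real.norm_eq_abs, abs_lt] at hε
    exact Real.sqrt_le_sqrt (by linarith [hε.1])
  have hsp : 0 < √(v / 2) := Real.sqrt_pos.2 (by positivity)
  have hball : Metric.ball (0 : ℝ) (v / 2) ∈ nhds (0 : ℝ) :=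
    Metric.ball_mem_nhds _ (by positivity)
  have h0mem : (0 : ℝ) ∈ Metric.ball (0 : ℝ) (v / 2) := Metric.mem_ball_self (by positivity)
  set D : ℝ := (C * M ^ m) * (C * M ^ m) with hD
  have hDint : ∀ (K : ℝ) (k l : ℕ), Integrable
      (fun u : ℝ × ℝ => K * ((1 + |u.1|) ^ k * (1 + |u.2|) ^ l))
      ((gaussianReal 0 1).prod (gaussianReal 0 1)) := fun K k l =>
    ((aux_int_pow k).mul_prod (aux_int_pow l)).const_mul K
  -- product bound
  have hprod : ∀ (g : ℝ → ℝ), (∀ t, |g t| ≤ C * (1 + |t|) ^ m) → ∀ b : ℝ, |b| ≤ M → ∀ x y : ℝ,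
      |φ (r * x) * g (a * x + b * y)| ≤ D * ((1 + |x|) ^ (m + m) * (1 + |y|) ^ m) := by
    intro g hg b hb x y
    have e1 := aux_growth2 φ C hC m g0 M r 0 x 0 hM1 hMr (by simp; linarith)
    simp only [mul_zero, add_zero, abs_zero, one_pow, mul_one] at e1
    have e2 := aux_growth2 g C hC m hg M a b x y hM1 hMa hb
    rw [abs_mul]
    calc _ ≤ _ := mul_le_mul e1 e2 (abs_nonneg _) (by positivity)
      _ = _ := by rw [hD, pow_add]; ring
  have main := hasDerivAt_integral_of_dominated_loc_of_deriv_le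
    (μ := (gaussianReal 0 1).prod (gaussianReal 0 1)) (x₀ := (0 : ℝ))
    (F := fun (ε : ℝ) (u : ℝ × ℝ) => φ (r * u.1) * φ (a * u.1 + √(v + ε) * u.2))
    (F' := fun (ε : ℝ) (u : ℝ × ℝ) =>
      φ (r * u.1) * (deriv φ (a * u.1 + √(v + ε) * u.2) * (1 / (2 * √(v + ε)) * u.2)))
    (bound := fun u => (D * (1 / (2 * √(v / 2)))) * ((1 + |u.1|) ^ (m + m) * (1 + |u.2|) ^ (m + 1)))
    hball
    (Filter.Eventually.of_forall fun ε => Continuous.aestronglyMeasurable (by fun_prop))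
    ((hDint D (m + m) m).mono' (Continuous.aestronglyMeasurable (by fun_prop))
      (Filter.Eventually.of_forall fun u => hprod φ g0 _ (hsM 0 h0mem) u.1 u.2))
    (Continuous.aestronglyMeasurable (by fun_prop))
    (Filter.Eventually.of_forall fun u ε hε => by
      have e := hprod (deriv φ) g1 _ (hsM ε hε) u.1 u.2
      have hpos : 0 < √(v + ε) := hsp.trans_le (hs0 ε hε)
      have e3 : |1 / (2 * √(v + ε)) * u.2| ≤ 1 / (2 * √(v / 2)) * (1 + |u.2|) := by
        rw [abs_mul, abs_of_pos (by positivity)]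
        have := hs0 ε hε
        gcongr
        linarith
      rw [← mul_assoc, Real.norm_eq_abs, abs_mul]
      calc _ ≤ _ := mul_le_mul e e3 (abs_nonneg _) (by positivity)
        _ = _ := by ring)
    (hDint _ _ _)
    (Filter.Eventually.of_forall fun u ε hε => by
      have hpos : 0 < √(v + ε) := hsp.trans_le (hs0 ε hε)
      have hne : v + ε ≠ 0 := (Real.sqrt_pos.1 hpos).ne'
      have hs : HasDerivAt (fun ε => √(v + ε)) (1 / (2 * √(v + ε))) ε :=
        ((hasDerivAt_id ε).const_add v).sqrt hne
      have hi : HasDerivAt (fun ε => a * u.1 + √(v + ε) * u.2) (1 / (2 * √(v + ε)) * u.2) ε :=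
        (hs.mul_const u.2).const_add _
      exact ((d0 _).comp ε hi).const_mul _)
  refine main.2.congr_deriv ?_
  have hint := main.1
  simp only [add_zero] at hint ⊢
  have hMs : |√v| ≤ M := by simpa using hsM 0 h0mem
  have hsv : 0 < √v := Real.sqrt_pos.2 hv
  rw [integral_prod _ hint, integral_prod, ← integral_const_mul]
  · congr 1
    ext x
    simp only []
    have st := aux_stein (fun y => deriv φ (a * x + √v * y))
      (fun y => deriv (deriv φ) (a * x + √v * y) * √v)
      (fun y => by
        have hi : HasDerivAt (fun y => a * x + √v * y) (√v) y := by
          simpa using ((hasDerivAt_id y).const_mul (√v)).const_add (a * x)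
        exact (d1 _).comp y hi) (by fun_prop)
      (C * M ^ m * (1 + |x|) ^ m * M) m
      (fun y => by
        have e := aux_growth2 _ C hC m g1 M a (√v) x y hM1 hMa hMs
        calc _ ≤ C * M ^ m * (1 + |x|) ^ m * (1 + |y|) ^ m * 1 := by rw [mul_one]; exact e
          _ ≤ C * M ^ m * (1 + |x|) ^ m * (1 + |y|) ^ m * M :=
            mul_le_mul_of_nonneg_left hM1 (by positivity)
          _ = _ := by ring)
      (fun y => by
        have e := aux_growth2 _ C hC m g2 M a (√v) x y hM1 hMa hMs
        rw [abs_mul]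
        calc _ ≤ C * M ^ m * (1 + |x|) ^ m * (1 + |y|) ^ m * M :=
              mul_le_mul e hMs (abs_nonneg _) (by positivity)
          _ = _ := by ring)
    rw [integral_mul_const] at st
    have l1 : ∫ y, φ (r * x) * (deriv φ (a * x + √v * y) * (1 / (2 * √v) * y)) ∂gaussianReal 0 1
        = (φ (r * x) * (1 / (2 * √v))) * ∫ y, y * deriv φ (a * x + √v * y) ∂gaussianReal 0 1 := by
      rw [← integral_const_mul]; congr 1; ext y; ring
    rw [l1, st, integral_const_mul]
    field_simp
  · exact (hDint D (m + m) m).mono' (Continuous.aestronglyMeasurable (by fun_prop))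
      (Filter.Eventually.of_forall fun u => hprod _ g2 _ hMs u.1 u.2)
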